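/- Let A_1 A_2 … A_n (n ≥ 3) be a convex n-gon with perimeter L (the sum of the side lengths ‖A_{k+1} − A_k‖, indices mod n). Then the minimum over k of the area of the ear A_{k−1} A_k A_{k+1} is at most L²·sin(2π/n)/(2n²). -/

import Mathlib

open MeasureTheory

/-- The area of a planar point set: the Lebesgue measure of its convex hull. -/
noncomputable def area (S : Set (ℝ × ℝ)) : ℝ :=
  (volume (convexHull ℝ S)).toReal

/-- Points in strictly convex position, affinely spanning the plane. -/
def StrictConvexPos {n : ℕ} (p : Fin n → ℝ × ℝ) : Prop :=
  (∀ i : Fin n, p i ∉ convexHull ℝ (p '' {j | j ≠ i})) ∧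
    affineSpan ℝ (Set.range p) = ⊤

/-- The cross product (twice the signed area) of the triangle `a b c`. -/
def Cross (a b c : ℝ × ℝ) : ℝ :=
  (b.1 - a.1) * (c.2 - a.2) - (b.2 - a.2) * (c.1 - a.1)

/-- The vertices `p 0, p 1, …, p (n-1)` are labeled in cyclic order around their
convex hull: all remaining vertices lie strictly on one and the same side of
each directed edge `p i → p (i+1)`. -/
def ConvexCyclic {n : ℕ} [NeZero n] (p : Fin n → ℝ × ℝ) : Prop :=
  (∀ i j : Fin n, j ≠ i → j ≠ i + 1 → 0 < Cross (p i) (p (i + 1)) (p j)) ∨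
  (∀ i j : Fin n, j ≠ i → j ≠ i + 1 → Cross (p i) (p (i + 1)) (p j) < 0)

/-- The Euclidean length of the side from `a` to `b`. -/
noncomputable def sideLength (a b : ℝ × ℝ) : ℝ :=
  Real.sqrt ((b.1 - a.1) ^ 2 + (b.2 - a.2) ^ 2)

open ComplexConjugate in
/-- The cross product of two complex numbers viewed as plane vectors. -/
noncomputable def Complex.cross (z w : ℂ) : ℝ := (conj z * w).im

namespace Complex

lemma cross_apply (z w : ℂ) : cross z w = z.re * w.im - z.im * w.re := by
  simp [cross]; ring

lemma ne_zero_left_of_cross_pos {z w : ℂ} (h : 0 < cross z w) : z ≠ 0 := by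
  rintro rfl; simp [cross] at h

lemma ne_zero_right_of_cross_pos {z w : ℂ} (h : 0 < cross z w) : w ≠ 0 := by
  rintro rfl; simp [cross] at h

lemma div_im_eq_cross (z w : ℂ) : (w / z).im = cross z w / normSq z := by
  rw [div_im, cross_apply]; ring

lemma div_im_pos_of_cross_pos {z w : ℂ} (h : 0 < cross z w) : 0 < (w / z).im := by
  rw [div_im_eq_cross]
  exact div_pos h (normSq_pos.2 (ne_zero_left_of_cross_pos h))

lemma arg_pos_of_im_pos {z : ℂ} (h : 0 < z.im) : 0 < arg z := by
  refine lt_of_le_of_ne (arg_nonneg_iff.2 h.le) fun h0 => ?_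
  have := (arg_eq_zero_iff.1 h0.symm).2
  linarith

lemma arg_lt_pi_of_im_pos {z : ℂ} (h : 0 < z.im) : arg z < Real.pi :=
  arg_lt_pi_iff.2 (Or.inr h.ne')

lemma arg_mul_of_im_pos {z w : ℂ} (hz : 0 < z.im) (hw : 0 < w.im) (hzw : 0 < (z * w).im) :
    arg (z * w) = arg z + arg w := by
  have hz0 : z ≠ 0 := by rintro rfl; simp at hz
  have hw0 : w ≠ 0 := by rintro rfl; simp at hw
  have h := arg_mul_coe_angle hz0 hw0
  rw [← Real.Angle.coe_add, Real.Angle.angle_eq_iff_two_pi_dvd_sub] at h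
  obtain ⟨k, hk⟩ := h
  have h1 := arg_pos_of_im_pos hz
  have h2 := arg_pos_of_im_pos hw
  have h3 := arg_pos_of_im_pos hzw
  have h4 := arg_lt_pi_of_im_pos hz
  have h5 := arg_lt_pi_of_im_pos hw
  have h6 := arg_lt_pi_of_im_pos hzw
  have hpi := Real.pi_pos
  have k1 : (k : ℝ) < 1 := by nlinarith
  have k2 : (-1 : ℝ) < k := by nlinarith
  have k1' : k < 1 := by exact_mod_cast k1
  have k2' : -1 < k := by exact_mod_cast k2
  obtain rfl : k = 0 := by omega
  simp at hk
  linarith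

lemma arg_div_eq_add_of_cross_pos {a b c : ℂ} (hab : 0 < cross a b) (hbc : 0 < cross b c)
    (hac : 0 < cross a c) : arg (c / a) = arg (b / a) + arg (c / b) := by
  have h : c / a = b / a * (c / b) := by
    have := ne_zero_left_of_cross_pos hab
    have := ne_zero_left_of_cross_pos hbc
    field_simp
  have hac' := div_im_pos_of_cross_pos hac
  rw [h] at hac' ⊢
  exact arg_mul_of_im_pos (div_im_pos_of_cross_pos hab) (div_im_pos_of_cross_pos hbc) hac'

lemma arg_neg_div_of_cross_pos {a b : ℂ} (h : 0 < cross a b) :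
    arg (-a / b) = Real.pi - arg (b / a) := by
  have hi := div_im_pos_of_cross_pos h
  have h1 : (b / a)⁻¹.im < 0 := by
    rw [inv_im]
    exact div_neg_of_neg_of_pos (by linarith) (normSq_pos.2 (by rintro h0; simp [h0] at hi))
  have h2 : -a / b = -(b / a)⁻¹ := by rw [inv_div, neg_div]
  rw [h2, arg_neg_eq_arg_add_pi_of_im_neg h1, arg_inv,
    if_neg (arg_lt_pi_of_im_pos hi).ne]
  ring

lemma cross_eq_norm_mul_sin {z w : ℂ} (hz : z ≠ 0) (hw : w ≠ 0) :
    cross z w = ‖z‖ * ‖w‖ * Real.sin (arg (w / z)) := by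
  have := norm_ne_zero_iff.2 hz
  have := norm_ne_zero_iff.2 hw
  rw [sin_arg, div_im_eq_cross, norm_div, normSq_eq_norm_sq]
  field_simp

/-- Partial sums of the exterior angles of a convex polygon, computed with the fan of diagonals
from the vertex `q 0`. -/
lemma sum_exterior_angle_partial {q : ℕ → ℂ} {m : ℕ}
    (hfan : ∀ k ≤ m, 0 < cross (q (k + 1) - q 0) (q (k + 2) - q 0))
    (hbase : ∀ k ≤ m, 0 < cross (q 1 - q 0) (q (k + 2) - q 0))
    (hear : ∀ k ≤ m, 0 < cross (q (k + 1) - q k) (q (k + 2) - q (k + 1))) :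
    ∑ k ∈ Finset.range (m + 1), arg ((q (k + 2) - q (k + 1)) / (q (k + 1) - q k)) =
      arg ((q (m + 2) - q 0) / (q 1 - q 0)) +
        arg ((q (m + 2) - q (m + 1)) / (q (m + 2) - q 0)) := by
  have hsplit : ∀ k ≤ m, arg ((q (k + 2) - q (k + 1)) / (q (k + 1) - q 0)) =
      arg ((q (k + 2) - q 0) / (q (k + 1) - q 0)) +
        arg ((q (k + 2) - q (k + 1)) / (q (k + 2) - q 0)) := fun k hk => by
    have h := hfan k hk
    simp only [cross_apply, sub_re, sub_im] at h
    refine arg_div_eq_add_of_cross_pos (hfan k hk) ?_ ?_ <;>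
      simp only [cross_apply, sub_re, sub_im] <;> linarith
  induction m with
  | zero => simpa using hsplit 0 le_rfl
  | succ m ih =>
    rw [Finset.sum_range_succ, ih (fun k hk => hfan k (by omega)) (fun k hk => hbase k (by omega))
      (fun k hk => hear k (by omega)) (fun k hk => hsplit k (by omega))]
    have h0 := hfan m (by omega)
    have h1 := hfan (m + 1) le_rfl
    have hturn : arg ((q (m + 3) - q (m + 2)) / (q (m + 2) - q 0)) =
        arg ((q (m + 2) - q (m + 1)) / (q (m + 2) - q 0)) +
          arg ((q (m + 3) - q (m + 2)) / (q (m + 2) - q (m + 1))) := by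
      refine arg_div_eq_add_of_cross_pos ?_ (hear (m + 1) le_rfl) ?_
      · simp only [cross_apply, sub_re, sub_im] at h0 ⊢; linarith
      · simp only [cross_apply, sub_re, sub_im] at h1 ⊢; linarith
    have hstep := arg_div_eq_add_of_cross_pos (hbase m (by omega)) h1 (hbase (m + 1) le_rfl)
    have hs := hsplit (m + 1) le_rfl
    simp only [add_assoc, Nat.reduceAdd] at *
    linarith

/-- The exterior angles of a convex polygon sum to `2π`. -/
lemma sum_exterior_angle {q : ℕ → ℂ} {m : ℕ}
    (h0 : q (m + 3) = q 0) (h1 : q (m + 4) = q 1)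
    (hfan : ∀ k ≤ m, 0 < cross (q (k + 1) - q 0) (q (k + 2) - q 0))
    (hbase : ∀ k ≤ m, 0 < cross (q 1 - q 0) (q (k + 2) - q 0))
    (hear : ∀ k ≤ m, 0 < cross (q (k + 1) - q k) (q (k + 2) - q (k + 1))) :
    ∑ k ∈ Finset.range (m + 3), arg ((q (k + 2) - q (k + 1)) / (q (k + 1) - q k)) =
      2 * Real.pi := by
  rw [Finset.sum_range_succ, Finset.sum_range_succ, sum_exterior_angle_partial hfan hbase hear]
  simp only [add_assoc, Nat.reduceAdd, h0, h1]
  have hlast : 0 < cross (q (m + 2) - q 0) (q (m + 2) - q (m + 1)) := by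
    have h := hfan m le_rfl
    simp only [cross_apply, sub_re, sub_im] at h ⊢; linarith
  have e1 := arg_neg_div_of_cross_pos hlast
  have e2 := arg_neg_div_of_cross_pos (hbase m le_rfl)
  rw [neg_sub] at e1
  rw [neg_div, ← div_neg, neg_sub] at e2
  rw [e1, e2]
  ring

end Complex

lemma Real.prod_le_arith_mean_pow {ι : Type*} (s : Finset ι) (hs : s.Nonempty) (f : ι → ℝ)
    (hf : ∀ i ∈ s, 0 ≤ f i) : ∏ i ∈ s, f i ≤ ((∑ i ∈ s, f i) / s.card) ^ s.card := by
  have hc : (s.card : ℝ) ≠ 0 := by exact_mod_cast hs.card_pos.ne'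
  have h := Real.geom_mean_le_arith_mean_weighted s (fun _ => (s.card : ℝ)⁻¹) f
    (fun _ _ => by positivity) (by simp [hc]) hf
  rw [Real.finsetProd_rpow _ _ hf, ← Finset.mul_sum, inv_mul_eq_div] at h
  have hp := Finset.prod_nonneg hf
  calc ∏ i ∈ s, f i = ((∏ i ∈ s, f i) ^ (s.card : ℝ)⁻¹) ^ s.card :=
        (Real.rpow_inv_natCast_pow hp hs.card_pos.ne').symm
    _ ≤ _ := by gcongr

lemma Real.sum_sin_le {ι : Type*} (s : Finset ι) (hs : s.Nonempty) (θ : ι → ℝ)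
    (hθ : ∀ i ∈ s, θ i ∈ Set.Icc 0 Real.pi) :
    (∑ i ∈ s, Real.sin (θ i)) / s.card ≤ Real.sin ((∑ i ∈ s, θ i) / s.card) := by
  have hc : (s.card : ℝ) ≠ 0 := by exact_mod_cast hs.card_pos.ne'
  have h := strictConcaveOn_sin_Icc.concaveOn.le_map_sum (t := s) (p := θ)
    (w := fun _ => (s.card : ℝ)⁻¹) (fun _ _ => by positivity) (by simp [hc]) hθ
  simp only [smul_eq_mul, ← Finset.mul_sum] at h
  simpa only [inv_mul_eq_div] using h

/-- The smallest ear of a convex polygon, in terms of complex vertices. -/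
lemma Complex.exists_cross_ear_le {q : ℕ → ℂ} {n : ℕ} (hn : 3 ≤ n)
    (h0 : q n = q 0) (h1 : q (n + 1) = q 1)
    (hfan : ∀ k, k + 2 < n → 0 < cross (q (k + 1) - q 0) (q (k + 2) - q 0))
    (hbase : ∀ k, k + 2 < n → 0 < cross (q 1 - q 0) (q (k + 2) - q 0))
    (hear : ∀ k < n, 0 < cross (q (k + 1) - q k) (q (k + 2) - q (k + 1))) :
    ∃ k < n, cross (q (k + 1) - q k) (q (k + 2) - q (k + 1)) ≤
      ((∑ k ∈ Finset.range n, ‖q (k + 1) - q k‖) / n) ^ 2 * Real.sin (2 * Real.pi / n) := by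
  by_contra! hcon
  set r := Finset.range n
  have hr : r.Nonempty := Finset.nonempty_range_iff.2 (by omega)
  have hcard : r.card = n := Finset.card_range n
  set θ : ℕ → ℝ := fun k => arg ((q (k + 2) - q (k + 1)) / (q (k + 1) - q k)) with hθ
  have hsum : ∑ k ∈ r, θ k = 2 * Real.pi := by
    obtain ⟨m, rfl⟩ : ∃ m, n = m + 3 := ⟨n - 3, by omega⟩
    exact sum_exterior_angle h0 h1 (fun k hk => hfan k (by omega))
      (fun k hk => hbase k (by omega)) (fun k hk => hear k (by omega))
  have hmem : ∀ k ∈ r, θ k ∈ Set.Icc 0 Real.pi := fun k hk =>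
    have h := div_im_pos_of_cross_pos (hear k (Finset.mem_range.1 hk))
    ⟨(arg_pos_of_im_pos h).le, (arg_lt_pi_of_im_pos h).le⟩
  have hsin := Real.sum_sin_le r hr θ hmem
  have hsinpos : ∀ k ∈ r, 0 ≤ Real.sin (θ k) := fun k hk => Real.sin_nonneg_of_mem_Icc (hmem k hk)
  have hps := Real.prod_le_arith_mean_pow r hr _ hsinpos
  have hpa := Real.prod_le_arith_mean_pow r hr (fun k => ‖q (k + 1) - q k‖)
    (fun _ _ => norm_nonneg _)
  rw [hcard] at hsin hps hpa
  rw [hsum] at hsin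
  set S := ∑ k ∈ r, ‖q (k + 1) - q k‖
  have hS : 0 ≤ S := Finset.sum_nonneg fun _ _ => norm_nonneg _
  have hsn : 0 ≤ (∑ k ∈ r, Real.sin (θ k)) / n :=
    div_nonneg (Finset.sum_nonneg hsinpos) (Nat.cast_nonneg n)
  have hshift : ∏ k ∈ r, ‖q (k + 2) - q (k + 1)‖ = ∏ k ∈ r, ‖q (k + 1) - q k‖ := by
    have h := (Finset.prod_range_succ' (fun k => ‖q (k + 1) - q k‖) n).symm.trans
      (Finset.prod_range_succ (fun k => ‖q (k + 1) - q k‖) n)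
    simp only [h0, h1, zero_add] at h
    refine mul_right_cancel₀ (norm_ne_zero_iff.2 ?_) h
    exact ne_zero_left_of_cross_pos (hear 0 (by omega))
  have hlt : ∏ _k ∈ r, ((S / n) ^ 2 * Real.sin (2 * Real.pi / n)) <
      ∏ k ∈ r, cross (q (k + 1) - q k) (q (k + 2) - q (k + 1)) := by
    have hpi : 0 < Real.sin (2 * Real.pi / n) := by
      have hn' : (3 : ℝ) ≤ n := by exact_mod_cast hn
      have := Real.pi_pos
      refine Real.sin_pos_of_pos_of_lt_pi (by positivity) ?_
      rw [div_lt_iff₀ (by linarith)]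
      nlinarith
    have hSpos : 0 < S := Finset.sum_pos (fun k hk =>
      norm_pos_iff.2 (ne_zero_left_of_cross_pos (hear k (Finset.mem_range.1 hk)))) hr
    have hnpos : (0 : ℝ) < n := by exact_mod_cast (by omega : 0 < n)
    exact Finset.prod_lt_prod_of_nonempty (fun _ _ => by positivity)
      (fun k hk => hcon k (Finset.mem_range.1 hk)) hr
  refine hlt.not_ge ?_
  rw [Finset.prod_const, hcard, Finset.prod_congr rfl fun k hk => cross_eq_norm_mul_sin
    (ne_zero_left_of_cross_pos (hear k (Finset.mem_range.1 hk)))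
    (ne_zero_right_of_cross_pos (hear k (Finset.mem_range.1 hk))),
    Finset.prod_mul_distrib, Finset.prod_mul_distrib, hshift]
  calc _ ≤ (S / n) ^ n * (S / n) ^ n * ((∑ k ∈ r, Real.sin (θ k)) / n) ^ n := by
        refine mul_le_mul (mul_le_mul hpa hpa ?_ (by positivity)) hps
          (Finset.prod_nonneg hsinpos) (by positivity)
        exact Finset.prod_nonneg fun _ _ => norm_nonneg _
    _ ≤ (S / n) ^ n * (S / n) ^ n * Real.sin (2 * Real.pi / n) ^ n :=
        mul_le_mul_of_nonneg_left (pow_le_pow_left₀ hsn hsin n) (by positivity)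
    _ = _ := by ring

lemma volume_standard_triangle_le :
    volume (convexHull ℝ {((0 : ℝ), (0 : ℝ)), (1, 0), (0, 1)}) ≤ ENNReal.ofReal (1 / 2) := by
  have hsub : convexHull ℝ {((0 : ℝ), (0 : ℝ)), (1, 0), (0, 1)} ⊆
      {x : ℝ × ℝ | x.1 ∈ Set.Icc 0 1 ∧ x.2 ∈ Set.Icc 0 (1 - x.1)} := by
    refine convexHull_min ?_ ?_
    · rintro x (rfl | rfl | rfl) <;> norm_num
    · rintro ⟨x, y⟩ ⟨⟨hx0, hx1⟩, hy0, hy1⟩ ⟨u, v⟩ ⟨⟨hu0, hu1⟩, hv0, hv1⟩ s t hs ht hst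
      simp only [Prod.smul_mk, smul_eq_mul, Prod.mk_add_mk, Set.mem_ofPred_eq, Set.mem_Icc] at *
      refine ⟨⟨by positivity, ?_⟩, by positivity, ?_⟩ <;> nlinarith
  refine (measure_mono hsub).trans (le_of_eq ?_)
  have hmeas : MeasurableSet {x : ℝ × ℝ | x.1 ∈ Set.Icc 0 1 ∧ x.2 ∈ Set.Icc 0 (1 - x.1)} := by
    measurability
  rw [Measure.volume_eq_prod, Measure.prod_apply hmeas]
  have hsec : ∀ x : ℝ, volume (Prod.mk x ⁻¹'
      {x : ℝ × ℝ | x.1 ∈ Set.Icc 0 1 ∧ x.2 ∈ Set.Icc 0 (1 - x.1)}) =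
      (Set.Icc (0 : ℝ) 1).indicator (fun x => ENNReal.ofReal (1 - x)) x := fun x => by
    by_cases hx : x ∈ Set.Icc (0 : ℝ) 1
    · have : Prod.mk x ⁻¹' {x : ℝ × ℝ | x.1 ∈ Set.Icc 0 1 ∧ x.2 ∈ Set.Icc 0 (1 - x.1)} =
          Set.Icc 0 (1 - x) := by
        ext y; simp only [Set.mem_preimage, Set.mem_ofPred_eq, hx, true_and]
      rw [this, Set.indicator_of_mem hx, Real.volume_Icc, sub_zero]
    · have : Prod.mk x ⁻¹' {x : ℝ × ℝ | x.1 ∈ Set.Icc 0 1 ∧ x.2 ∈ Set.Icc 0 (1 - x.1)} = ∅ := by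
        ext y; simp only [Set.mem_preimage, Set.mem_ofPred_eq, hx, false_and, Set.mem_empty_iff_false]
      rw [this, Set.indicator_of_notMem hx, measure_empty]
  simp_rw [hsec]
  rw [lintegral_indicator measurableSet_Icc, ← ofReal_integral_eq_lintegral_ofReal]
  · rw [integral_Icc_eq_integral_Ioc, ← intervalIntegral.integral_of_le zero_le_one]
    congr 1
    rw [intervalIntegral.integral_sub (by simp) (by simp)]
    norm_num
  · exact (by fun_prop : Continuous fun x : ℝ => 1 - x).integrableOn_Icc
  · filter_upwards [ae_restrict_mem measurableSet_Icc] with x hx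
    exact sub_nonneg.2 hx.2

lemma area_triangle_le (a b c : ℝ × ℝ) : area {a, b, c} ≤ |Cross a b c| / 2 := by
  set f : (ℝ × ℝ) →ₗ[ℝ] ℝ × ℝ := Matrix.toLin (Module.Basis.finTwoProd ℝ) (Module.Basis.finTwoProd ℝ)
    !![b.1 - a.1, c.1 - a.1; b.2 - a.2, c.2 - a.2] with hf
  have hdet : LinearMap.det f = Cross a b c := by
    rw [hf, LinearMap.det_toLin, Matrix.det_fin_two_of, Cross]
    ring
  have himage : convexHull ℝ {a, b, c} =
      (fun x => a + x) '' (f '' convexHull ℝ {((0 : ℝ), (0 : ℝ)), (1, 0), (0, 1)}) := by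
    have hadd := (AffineEquiv.constVAdd ℝ (ℝ × ℝ) a).toAffineMap.image_convexHull
      (f '' {((0 : ℝ), (0 : ℝ)), (1, 0), (0, 1)})
    rw [← f.image_convexHull] at hadd
    refine Eq.trans ?_ hadd.symm
    have htip : ∀ x : ℝ × ℝ, a + (x.1 - a.1, x.2 - a.2) = x := fun x => by ext <;> simp
    simp [Set.image_insert_eq, hf, Matrix.toLin_finTwoProd_apply, Prod.mk_zero_zero, htip]
  have hvol : volume (convexHull ℝ {a, b, c}) ≤ ENNReal.ofReal (|Cross a b c| / 2) := by
    rw [himage, Set.image_add_left, measure_preimage_add, Measure.addHaar_image_linearMap, hdet]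
    calc _ ≤ ENNReal.ofReal |Cross a b c| * ENNReal.ofReal (1 / 2) := by
          gcongr; exact volume_standard_triangle_le
      _ = _ := by rw [← ENNReal.ofReal_mul (abs_nonneg _), mul_one_div]
  exact ENNReal.toReal_le_of_le_ofReal (by positivity) hvol

/-- For a convex `n`-gon with perimeter `L`, the smallest ear has area at most
`L²·sin(2π/n)/(2n²)`. -/
theorem min_ear_perimeter_bound
    (n : ℕ) [NeZero n] (hn : 3 ≤ n)
    (p : Fin n → ℝ × ℝ) (hp : StrictConvexPos p) (hcyc : ConvexCyclic p)
    (L : ℝ) (hL : L = ∑ k : Fin n, sideLength (p k) (p (k + 1))) :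
    ∃ i : Fin n, area {p (i - 1), p i, p (i + 1)} ≤
      L ^ 2 * Real.sin (2 * Real.pi / n) / (2 * (n : ℝ) ^ 2) := by
  obtain ⟨σ, hσ, hpos⟩ : ∃ σ : ℝ, σ ^ 2 = 1 ∧
      ∀ i j : Fin n, j ≠ i → j ≠ i + 1 → 0 < σ * Cross (p i) (p (i + 1)) (p j) := by
    rcases hcyc with h | h
    · exact ⟨1, by norm_num, fun i j h1 h2 => by linarith [h i j h1 h2]⟩
    · exact ⟨-1, by norm_num, fun i j h1 h2 => by linarith [h i j h1 h2]⟩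
  set e : ℕ → Fin n := Fin.ofNat n with he
  set q : ℕ → ℂ := fun k => ⟨(p (e k)).1, σ * (p (e k)).2⟩ with hq
  have hsucc : ∀ k, e (k + 1) = e k + 1 := fun k => by
    ext; simp [he, Fin.val_add]
  have hval : ∀ k, (e k : ℕ) = k % n := fun k => rfl
  have hne : ∀ {i j : ℕ}, i < j → j < i + n → e j ≠ e i := fun {i j} hij hjn h => by
    have h := congrArg Fin.val h
    rw [hval, hval] at h
    have := (Nat.modEq_iff_dvd' hij.le).1 h.symm
    have := Nat.le_of_dvd (by omega) this
    omega
  have hn0 : ∀ k, e (k + n) = e k := fun k => by ext; simp [he]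
  have hcross : ∀ i j k, Complex.cross (q j - q i) (q k - q i) =
      σ * Cross (p (e i)) (p (e j)) (p (e k)) := fun i j k => by
    simp only [hq, Complex.cross_apply, Complex.sub_re, Complex.sub_im, Cross]; ring
  have hedge : ∀ i k, i + 1 < k → k < i + n →
      0 < Complex.cross (q (i + 1) - q i) (q k - q i) := fun i k h1 h2 => by
    rw [hcross, hsucc]
    refine hpos _ _ (hne (by omega) h2) ?_
    rw [← hsucc]
    exact hne h1 (by omega)
  have hq0 : q n = q 0 := by have := hn0 0; simp only [zero_add] at this; simp only [hq, this]
  have hq1 : q (n + 1) = q 1 := by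
    have := hn0 1; rw [add_comm] at this; simp only [hq, this]
  have hrot : ∀ a b c : ℂ, Complex.cross (b - a) (c - b) = Complex.cross (b - a) (c - a) :=
    fun a b c => by simp only [Complex.cross_apply, Complex.sub_re, Complex.sub_im]; ring
  have hside : ∀ k, ‖q (k + 1) - q k‖ = sideLength (p (e k)) (p (e k + 1)) := fun k => by
    rw [← hsucc, Complex.norm_eq_sqrt_sq_add_sq, sideLength]
    congr 1
    simp only [hq, Complex.sub_re, Complex.sub_im]
    linear_combination ((p (e (k + 1))).2 - (p (e k)).2) ^ 2 * hσ
  have hper : ∑ k ∈ Finset.range n, ‖q (k + 1) - q k‖ = L := by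
    rw [hL, Finset.sum_range]
    refine Finset.sum_congr rfl fun k _ => ?_
    rw [hside, show e k = k from by ext; simp [he]]
  obtain ⟨k, -, hle⟩ := Complex.exists_cross_ear_le hn hq0 hq1
    (fun k hk => by
      have h := hedge (k + 1) n (by omega) (by omega)
      rw [hq0] at h
      simp only [Complex.cross_apply, Complex.sub_re, Complex.sub_im, add_assoc,
        Nat.reduceAdd] at h ⊢
      linarith)
    (fun k hk => hedge 0 (k + 2) (by omega) (by omega))
    (fun k _ => by rw [hrot]; exact hedge k (k + 2) (by omega) (by omega))
  refine ⟨e (k + 1), (area_triangle_le _ _ _).trans ?_⟩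
  rw [hper, hrot, hcross] at hle
  have hearpos := hedge k (k + 2) (by omega) (by omega)
  rw [hcross] at hearpos
  have habs : |σ| = 1 := by rwa [← sq_eq_sq₀ (abs_nonneg _) zero_le_one, sq_abs, one_pow]
  have h1 : e (k + 1) - 1 = e k := by rw [hsucc, add_sub_cancel_right]
  rw [h1, ← hsucc, ← one_mul |_|, ← habs, ← abs_mul, abs_of_pos hearpos]
  calc _ ≤ ((L / n) ^ 2 * Real.sin (2 * Real.pi / n)) / 2 := by gcongr
    _ = _ := by rw [div_pow]; ring
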